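/- For every compact set K ⊂ Ω there exists a constant C > 0, depending only on a, b, β and K, such that for every V : closure(Ω) → ℝ with a ≤ V ≤ b and every classical solution u of problem (P_β) relative to V one has ∫_K |x-x₀|^{2β} e^{u(x)} dx ≤ C. -/

import Mathlib

open MeasureTheory Real RealInnerProductSpace

noncomputable section

/-- The Euclidean plane ℝ². -/
abbrev E2 := EuclideanSpace ℝ (Fin 2)

/-- The open annulus `{x : R₂ < |x| < R₁}` centered at the origin. -/
def ann (R₂ R₁ : ℝ) : Set E2 := {x : E2 | R₂ < ‖x‖ ∧ ‖x‖ < R₁}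

/-- `Ω`, the open annulus of radii 1/2 and 1 centered at the origin. -/
def Omega : Set E2 := ann (1/2) 1

/-- The Laplacian `Δ = ∂₁₁ + ∂₂₂` on ℝ². -/
def lap (u : E2 → ℝ) (x : E2) : ℝ :=
  ∑ i : Fin 2,
    iteratedFDeriv ℝ 2 u x ![EuclideanSpace.single i 1, EuclideanSpace.single i 1]

/-- The point `r (cos θ, sin θ)` on the circle of radius `r`. -/
def circlePt (r θ : ℝ) : E2 :=
  (WithLp.equiv 2 (Fin 2 → ℝ)).symm ![r * Real.cos θ, r * Real.sin θ]

/-- Arc-length integral of `f` over the circle `C(r) = {x : |x| = r}` centered at the origin: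
`∫_{C(r)} f dσ = ∫_0^{2π} f(r cos θ, r sin θ) r dθ`. -/
def circleIntR (f : E2 → ℝ) (r : ℝ) : ℝ := ∫ θ in (0:ℝ)..(2 * π), f (circlePt r θ) * r

/-- A classical solution of problem (P): `u ∈ C²(closure Ω)`, `u = 0` on `∂Ω`, and
`-Δu = (1 + |x - x₀|^{2β}) V e^u` in `Ω`. -/
def IsSolP (β : ℝ) (x₀ : E2) (V u : E2 → ℝ) : Prop :=
  ContDiffOn ℝ 2 u (closure Omega) ∧
  (∀ x ∈ frontier Omega, u x = 0) ∧
  ∀ x ∈ Omega, -lap u x = (1 + ‖x - x₀‖ ^ (2 * β)) * V x * Real.exp (u x)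

/-- A classical solution of problem (P_β): `u ∈ C²(closure Ω)`, `u = 0` on `∂Ω`, and
`-Δu = |x - x₀|^{2β} V e^u` in `Ω`. -/
def IsSolPbeta (β : ℝ) (x₀ : E2) (V u : E2 → ℝ) : Prop :=
  ContDiffOn ℝ 2 u (closure Omega) ∧
  (∀ x ∈ frontier Omega, u x = 0) ∧
  ∀ x ∈ Omega, -lap u x = ‖x - x₀‖ ^ (2 * β) * V x * Real.exp (u x)

theorem aux_isOpen_Omega : IsOpen Omega := by
  have : Omega = {x : E2 | (1/2:ℝ) < ‖x‖} ∩ {x : E2 | ‖x‖ < 1} := rfl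
  rw [this]
  exact (isOpen_lt continuous_const continuous_norm).inter
    (isOpen_lt continuous_norm continuous_const)

theorem aux_isCompact_closure : IsCompact (closure Omega) := by
  apply Bornology.IsBounded.isCompact_closure
  refine (Metric.isBounded_closedBall (x := (0:E2)) (r := 1)).subset ?_
  intro x hx
  simpa using hx.2.le

theorem aux_lap (u : E2 → ℝ) (x : E2) :
    lap u x = ∑ i : Fin 2, fderiv ℝ (fderiv ℝ u) x (EuclideanSpace.single i 1)
      (EuclideanSpace.single i 1) := by
  simp [lap, iteratedFDeriv_two_apply]

theorem aux_continuous_mul {f g : E2 → ℝ} {O : Set E2} (hO : IsOpen O) (hf : ContinuousOn f O)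
    (hg : Continuous g) (hs : tsupport g ⊆ O) : Continuous (fun x => f x * g x) := by
  rw [continuous_iff_continuousAt]
  intro x
  by_cases hx : x ∈ O
  · exact (hf.continuousAt (hO.mem_nhds hx)).mul hg.continuousAt
  · have h0 : x ∉ tsupport g := fun h => hx (hs h)
    rw [notMem_tsupport_iff_eventuallyEq] at h0
    have : (fun x => f x * g x) =ᶠ[nhds x] fun _ => 0 := by
      filter_upwards [h0] with y hy
      simp [hy]
    exact (continuousAt_congr this).2 continuousAt_const

theorem aux_integrable {f g : E2 → ℝ} {O : Set E2} (hO : IsOpen O) (hf : ContinuousOn f O)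
    (hg : Continuous g) (hs : tsupport g ⊆ O) (hc : HasCompactSupport g) :
    Integrable (fun x => f x * g x) :=
  (aux_continuous_mul hO hf hg hs).integrable_of_hasCompactSupport hc.mul_left

theorem aux_green1 {u φ : E2 → ℝ} {O : Set E2} (hO : IsOpen O) (hu : ContDiffOn ℝ 2 u O)
    (hφ : ContDiff ℝ 2 φ) (hs : tsupport φ ⊆ O) (hc : HasCompactSupport φ) (v : E2) :
    Integrable (fun x => φ x * fderiv ℝ (fderiv ℝ u) x v v) ∧
    Integrable (fun x => u x * fderiv ℝ (fderiv ℝ φ) x v v) ∧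
    ∫ x, φ x * fderiv ℝ (fderiv ℝ u) x v v = ∫ x, u x * fderiv ℝ (fderiv ℝ φ) x v v := by
  have hdu : ContDiffOn ℝ 1 (fderiv ℝ u) O := hu.fderiv_of_isOpen hO (by norm_num)
  have hddu : ContDiffOn ℝ 0 (fderiv ℝ (fderiv ℝ u)) O := hdu.fderiv_of_isOpen hO (by norm_num)
  have hdφ : ContDiff ℝ 1 (fderiv ℝ φ) := hφ.fderiv_right (by norm_num)
  have hddφ : ContDiff ℝ 0 (fderiv ℝ (fderiv ℝ φ)) := hdφ.fderiv_right (by norm_num)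
  have hduv : ContDiffOn ℝ 1 (fun x => fderiv ℝ u x v) O := hdu.clm_apply contDiffOn_const
  have hdφv : ContDiff ℝ 1 (fun x => fderiv ℝ φ x v) := hdφ.clm_apply contDiff_const
  have c1 : ContinuousOn (fun x => fderiv ℝ (fderiv ℝ u) x v v) O :=
    (hddu.continuousOn.clm_apply continuousOn_const).clm_apply continuousOn_const
  have c2 : Continuous (fun x => fderiv ℝ (fderiv ℝ φ) x v v) :=
    (hddφ.continuous.clm_apply continuous_const).clm_apply continuous_const
  have e1 : ∀ x ∈ O, fderiv ℝ (fun x => fderiv ℝ u x v) x v = fderiv ℝ (fderiv ℝ u) x v v := by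
    intro x hx
    have : DifferentiableAt ℝ (fderiv ℝ u) x :=
      (hdu.contDiffAt (hO.mem_nhds hx)).differentiableAt (by norm_num)
    rw [fderiv_clm_apply this (differentiableAt_const v)]
    simp
  have e2 : ∀ x, fderiv ℝ (fun x => fderiv ℝ φ x v) x v = fderiv ℝ (fderiv ℝ φ) x v v := by
    intro x
    have : DifferentiableAt ℝ (fderiv ℝ φ) x := hdφ.differentiable (by norm_num) x
    rw [fderiv_clm_apply this (differentiableAt_const v)]
    simp
  have e1' : ∀ x, φ x * fderiv ℝ (fun x => fderiv ℝ u x v) x v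
      = φ x * fderiv ℝ (fderiv ℝ u) x v v := by
    intro x
    by_cases hx : x ∈ O
    · rw [e1 x hx]
    · rw [image_eq_zero_of_notMem_tsupport (fun h => hx (hs h))]; simp
  have s1 : tsupport (fun x => fderiv ℝ φ x v) ⊆ tsupport φ := tsupport_fderiv_apply_subset ℝ v
  have k1 : HasCompactSupport (fun x => fderiv ℝ φ x v) := hc.fderiv_apply ℝ v
  have s2 : tsupport (fun x => fderiv ℝ (fderiv ℝ φ) x v v) ⊆ tsupport φ := by
    simp_rw [← e2]
    exact (tsupport_fderiv_apply_subset ℝ v).trans s1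
  have k2 : HasCompactSupport (fun x => fderiv ℝ (fderiv ℝ φ) x v v) := by
    simp_rw [← e2]
    exact k1.fderiv_apply ℝ v
  have i1 : Integrable (fun x => φ x * fderiv ℝ (fderiv ℝ u) x v v) := by
    simpa [mul_comm] using aux_integrable hO c1 hφ.continuous hs hc
  have i2 := aux_integrable hO hu.continuousOn c2 (s2.trans hs) k2
  have i3 := aux_integrable hO hduv.continuousOn hdφv.continuous (s1.trans hs) k1
  have i4 := aux_integrable hO hu.continuousOn hdφv.continuous (s1.trans hs) k1
  have i5 := aux_integrable hO hduv.continuousOn hφ.continuous hs hc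
  refine ⟨i1, i2, ?_⟩
  have A := integral_mul_fderiv_eq_neg_fderiv_mul_of_integrable (μ := volume) (f := φ)
    (g := fun x => fderiv ℝ u x v) (v := v) (by simpa [mul_comm] using i3)
    (by simpa only [e1'] using i1) (by simpa [mul_comm] using i5)
    (fun x _ => hφ.differentiable (by norm_num) x)
    (fun x hx => (hduv.contDiffAt (hO.mem_nhds (hs hx))).differentiableAt (by norm_num))
  have B := integral_mul_fderiv_eq_neg_fderiv_mul_of_integrable (μ := volume) (f := u)
    (g := fun x => fderiv ℝ φ x v) (v := v) i3
    (by simpa only [e2] using i2) i4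
    (fun x hx => (hu.contDiffAt (hO.mem_nhds (hs (s1 hx)))).differentiableAt (by norm_num))
    (fun x _ => hdφv.differentiable (by norm_num) x)
  simp only [e1'] at A
  simp only [e2] at B
  rw [A, B]
  simp [mul_comm]

theorem aux_green {u φ : E2 → ℝ} {O : Set E2} (hO : IsOpen O) (hu : ContDiffOn ℝ 2 u O)
    (hφ : ContDiff ℝ 2 φ) (hs : tsupport φ ⊆ O) (hc : HasCompactSupport φ) :
    Integrable (fun x => φ x * lap u x) ∧ Integrable (fun x => u x * lap φ x) ∧
    ∫ x, φ x * lap u x = ∫ x, u x * lap φ x := by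
  have h := fun i : Fin 2 => aux_green1 hO hu hφ hs hc (EuclideanSpace.single i 1)
  simp only [aux_lap, Finset.mul_sum]
  refine ⟨integrable_finsetSum _ fun i _ => (h i).1,
    integrable_finsetSum _ fun i _ => (h i).2.1, ?_⟩
  rw [integral_finsetSum _ fun i _ => (h i).1, integral_finsetSum _ fun i _ => (h i).2.1]
  exact Finset.sum_congr rfl fun i _ => (h i).2.2

/-- The factor in `Δ(η⁴) = η² G`. -/
def auxG (η : E2 → ℝ) (x : E2) : ℝ :=
  ∑ i : Fin 2, (4 * η x * fderiv ℝ (fderiv ℝ η) x (EuclideanSpace.single i 1)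
      (EuclideanSpace.single i 1) + 12 * (fderiv ℝ η x (EuclideanSpace.single i 1)) ^ 2)

theorem aux_lap_pow {η : E2 → ℝ} (hη : ContDiff ℝ 2 η) (x : E2) :
    lap (fun y => η y ^ 4) x = η x ^ 2 * auxG η x := by
  have hd : Differentiable ℝ η := hη.differentiable (by norm_num)
  have hdη : ContDiff ℝ 1 (fderiv ℝ η) := hη.fderiv_right (by norm_num)
  have hdd : Differentiable ℝ (fderiv ℝ η) := hdη.differentiable (by norm_num)
  have h1 : fderiv ℝ (fun y => η y ^ 4) = fun y => (4 * η y ^ 3) • fderiv ℝ η y := by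
    funext y
    have := ((hd y).hasFDerivAt.pow 4).fderiv
    rw [this]
    simp
  have h2 : HasFDerivAt (fun y => (4 * η y ^ 3) • fderiv ℝ η y) _ x :=
    (((hd x).hasFDerivAt.pow 3).const_mul 4).smul (hdd x).hasFDerivAt
  rw [aux_lap, h1, h2.fderiv, auxG, Finset.mul_sum]
  refine Finset.sum_congr rfl fun i _ => ?_
  simp
  ring

theorem aux_G_cont {η : E2 → ℝ} (hη : ContDiff ℝ 2 η) : Continuous (auxG η) := by
  have hdη : ContDiff ℝ 1 (fderiv ℝ η) := hη.fderiv_right (by norm_num)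
  have hddη : ContDiff ℝ 0 (fderiv ℝ (fderiv ℝ η)) := hdη.fderiv_right (by norm_num)
  have c0 := hη.continuous
  have c1 := hdη.continuous
  have c2 := hddη.continuous
  unfold auxG
  fun_prop

theorem aux_G_supp {η : E2 → ℝ} (hc : HasCompactSupport η) : HasCompactSupport (auxG η) := by
  refine HasCompactSupport.intro hc ?_
  intro x hx
  simp [auxG, image_eq_zero_of_notMem_tsupport hx, fderiv_of_notMem_tsupport ℝ hx]

theorem aux_second {u : E2 → ℝ} {x v : E2} (hu : ContDiffAt ℝ 2 u x) (hm : IsLocalMin u x) :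
    0 ≤ fderiv ℝ (fderiv ℝ u) x v v := by
  by_contra hneg
  push Not at hneg
  set g : ℝ → ℝ := fun t => u (x + t • v) with hg
  have hl : ∀ t : ℝ, HasDerivAt (fun t : ℝ => x + t • v) v t := by
    intro t
    simpa using ((hasDerivAt_id t).smul_const v).const_add x
  have hl0 : Filter.Tendsto (fun t : ℝ => x + t • v) (nhds 0) (nhds x) := by
    have := (hl 0).continuousAt.tendsto
    simpa using this
  have hd : ∀ᶠ y in nhds x, DifferentiableAt ℝ u y := by
    filter_upwards [hu.eventually (by norm_num)] with y hy
    exact hy.differentiableAt (by norm_num)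
  have hgd : ∀ᶠ t in nhds (0:ℝ), deriv g t = fderiv ℝ u (x + t • v) v := by
    filter_upwards [hl0.eventually hd] with t ht
    exact (ht.hasFDerivAt.comp_hasDerivAt t (hl t)).deriv
  have hdu : ContDiffAt ℝ 1 (fderiv ℝ u) x := hu.fderiv_right (by norm_num)
  have hddg : deriv (deriv g) 0 = fderiv ℝ (fderiv ℝ u) x v v := by
    rw [Filter.EventuallyEq.deriv_eq (show deriv g =ᶠ[nhds 0] _ from hgd)]
    have hdx : HasFDerivAt (fderiv ℝ u) (fderiv ℝ (fderiv ℝ u) x) (x + (0:ℝ) • v) := by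
      simpa using (hdu.differentiableAt (by norm_num)).hasFDerivAt
    have hh : HasDerivAt (fun t : ℝ => fderiv ℝ u (x + t • v)) (fderiv ℝ (fderiv ℝ u) x v) 0 :=
      hdx.comp_hasDerivAt (0:ℝ) (hl 0)
    have hk : HasDerivAt (fun t : ℝ => fderiv ℝ u (x + t • v) v)
        (fderiv ℝ (fderiv ℝ u) x v v) 0 :=
      (ContinuousLinearMap.apply ℝ ℝ v).hasFDerivAt.comp_hasDerivAt (0:ℝ) hh
    exact hk.deriv
  have hmin : IsLocalMin g 0 := by
    have := hl0.eventually hm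
    filter_upwards [this] with t ht
    simpa [hg] using ht
  have hcg : ContinuousAt g 0 := by
    have : ContinuousAt u (x + (0:ℝ) • v) := by simpa using hu.continuousAt
    exact ContinuousAt.comp (f := fun t : ℝ => x + t • v) this (hl 0).continuousAt
  have hmax : IsLocalMax g 0 :=
    isLocalMax_of_deriv_deriv_neg (by rw [hddg]; exact hneg) hmin.deriv_eq_zero hcg
  have hconst : g =ᶠ[nhds 0] fun _ => g 0 := by
    filter_upwards [hmin, hmax] with t h1 h2
    exact le_antisymm h2 h1
  have : deriv (deriv g) 0 = 0 := by
    rw [hconst.deriv.deriv_eq]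
    simp
  linarith

theorem aux_nonneg {u : E2 → ℝ} (hu : ContDiffOn ℝ 2 u (closure Omega))
    (h0 : ∀ x ∈ frontier Omega, u x = 0) (hl : ∀ x ∈ Omega, lap u x < 0) :
    ∀ x ∈ Omega, 0 ≤ u x := by
  intro x hx
  obtain ⟨y, hy, hmin⟩ := aux_isCompact_closure.exists_isMinOn ⟨x, subset_closure hx⟩
    hu.continuousOn
  have hyx : u y ≤ u x := hmin (subset_closure hx)
  by_cases hyO : y ∈ Omega
  · have hn : closure Omega ∈ nhds y :=
      Filter.mem_of_superset (aux_isOpen_Omega.mem_nhds hyO) subset_closure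
    have := hl y hyO
    rw [aux_lap] at this
    have h2 : 0 ≤ ∑ i : Fin 2, fderiv ℝ (fderiv ℝ u) y (EuclideanSpace.single i 1)
      (EuclideanSpace.single i 1) :=
      Finset.sum_nonneg fun i _ => aux_second (hu.contDiffAt hn) (hmin.isLocalMin hn)
    linarith
  · have : y ∈ frontier Omega := by
      rw [aux_isOpen_Omega.frontier_eq]
      exact ⟨hy, hyO⟩
    rw [h0 y this] at hyx
    exact hyx

theorem aux_bump (K : Set E2) (hK : IsCompact K) (hKΩ : K ⊆ Omega) :
    ∃ η : E2 → ℝ, ContDiff ℝ 2 η ∧ HasCompactSupport η ∧ tsupport η ⊆ Omega ∧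
      ∀ x ∈ K, η x = 1 := by
  obtain ⟨L, hL, hKL, hLO⟩ := exists_compact_between hK aux_isOpen_Omega hKΩ
  obtain ⟨f, h1, h2, -⟩ := exists_contMDiffMap_one_nhds_of_subset_interior
    (n := 2) (modelWithCornersSelf ℝ E2) hK.isClosed hKL
  have hsub : tsupport f ⊆ L :=
    closure_minimal (fun x hx => by_contra fun h => hx (h2 x h)) hL.isClosed
  exact ⟨f, f.contMDiff.contDiff, hL.of_isClosed_subset (isClosed_tsupport _) hsub,
    hsub.trans hLO, fun x hx => h1.self_of_nhdsSet x hx⟩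

theorem aux_weight (β : ℝ) (S : Set E2) (hS : IsCompact S) (hSO : S ⊆ Omega) :
    ∃ w > (0:ℝ), ∀ x₀ : E2, ‖x₀‖ = 1/2 → ∀ x ∈ S, w ≤ ‖x - x₀‖ ^ (2 * β) := by
  have hc : IsCompact (S ×ˢ Metric.sphere (0:E2) (1/2)) := hS.prod (isCompact_sphere _ _)
  have hpos : ∀ p ∈ S ×ˢ Metric.sphere (0:E2) (1/2), 0 < ‖p.1 - p.2‖ := by
    rintro ⟨x, y⟩ ⟨hx, hy⟩
    change x ∈ S at hx
    change y ∈ _ at hy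
    change 0 < ‖x - y‖
    rw [norm_pos_iff, sub_ne_zero]
    rintro rfl
    have h1 := (hSO hx).1
    have h2 : ‖x‖ = 1/2 := by simpa using hy
    change (1/2:ℝ) < ‖x‖ at h1
    linarith
  have hcont : ContinuousOn (fun p : E2 × E2 => ‖p.1 - p.2‖ ^ (2 * β))
      (S ×ˢ Metric.sphere (0:E2) (1/2)) := by
    refine ContinuousOn.rpow_const (by fun_prop) ?_
    intro p hp
    exact Or.inl (hpos p hp).ne'
  obtain ⟨w, hw, h⟩ := hc.exists_forall_le' hcont (a := 0)
    (fun p hp => Real.rpow_pos_of_pos (hpos p hp) _)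
  exact ⟨w, hw, fun x₀ hx₀ x hx => h (x, x₀) ⟨hx, by simpa using hx₀⟩⟩

theorem aux_pow_supp {f : E2 → ℝ} (hc : HasCompactSupport f) (n : ℕ) (hn : n ≠ 0) :
    HasCompactSupport (fun x => f x ^ n) := by
  refine HasCompactSupport.intro hc ?_
  intro x hx
  simp [image_eq_zero_of_notMem_tsupport hx, hn]

theorem aux_pow_tsupp (f : E2 → ℝ) (n : ℕ) (hn : n ≠ 0) :
    tsupport (fun x => f x ^ n) ⊆ tsupport f := by
  refine closure_mono fun x hx => ?_
  intro h
  exact hx (by simp [h, hn])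

/-- Local (interior) volume bound for (P_β): for every compact `K ⊆ Ω` there is `C > 0`
depending only on `a, b, β, K` with `∫_K |x - x₀|^{2β} e^u ≤ C` for every solution. -/
theorem local_volume_bound_Pbeta (β a b : ℝ) (hβ : -(1/2) < β) (ha : 0 < a) (hab : a ≤ b)
    (K : Set E2) (hK : IsCompact K) (hKΩ : K ⊆ Omega) :
    ∃ C > (0:ℝ), ∀ (x₀ : E2), ‖x₀‖ = 1/2 →
      ∀ V u : E2 → ℝ,
        (∀ x ∈ closure Omega, a ≤ V x ∧ V x ≤ b) →
        IsSolPbeta β x₀ V u →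
        ∫ x in K, ‖x - x₀‖ ^ (2 * β) * Real.exp (u x) ≤ C := by
  obtain ⟨η, hη, hc, hs, hK1⟩ := aux_bump K hK hKΩ
  obtain ⟨w, hw, hW⟩ := aux_weight β _ hc hs
  have hO := aux_isOpen_Omega
  have hGi : Integrable (fun x => (auxG η x) ^ 2) := by
    refine ((aux_G_cont hη).pow 2).integrable_of_hasCompactSupport ?_
    exact aux_pow_supp (aux_G_supp hc) 2 two_ne_zero
  refine ⟨2 / a * (2 / (a * w) * ∫ x, (auxG η x) ^ 2) + 1, ?_, ?_⟩
  · have : 0 ≤ ∫ x, (auxG η x) ^ 2 := integral_nonneg fun x => sq_nonneg _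
    positivity
  intro x₀ hx₀ V u hV hsol
  obtain ⟨hu, hb, heq⟩ := hsol
  have huO : ContDiffOn ℝ 2 u Omega := hu.mono subset_closure
  have hne : ∀ x ∈ Omega, 0 < ‖x - x₀‖ := by
    intro x hx
    rw [norm_pos_iff, sub_ne_zero]
    rintro rfl
    have h1 : (1/2:ℝ) < ‖x‖ := hx.1
    linarith
  have hWp : ∀ x ∈ Omega, 0 < ‖x - x₀‖ ^ (2 * β) := fun x hx => Real.rpow_pos_of_pos (hne x hx) _
  have hlow : ∀ x ∈ Omega, a * (‖x - x₀‖ ^ (2 * β) * Real.exp (u x)) ≤ -lap u x := by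
    intro x hx
    rw [heq x hx]
    have h1 := (hV x (subset_closure hx)).1
    have h2 := mul_le_mul_of_nonneg_right h1 (mul_pos (hWp x hx) (Real.exp_pos (u x))).le
    linarith
  have hupos : ∀ x ∈ Omega, 0 ≤ u x := by
    refine aux_nonneg hu hb fun x hx => ?_
    have := hlow x hx
    have h2 := mul_pos ha (mul_pos (hWp x hx) (Real.exp_pos (u x)))
    linarith
  have hφ : ContDiff ℝ 2 (fun y => η y ^ 4) := hη.pow 4
  have hφs : tsupport (fun y => η y ^ 4) ⊆ tsupport η :=
    aux_pow_tsupp η 4 four_ne_zero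
  have hφc : HasCompactSupport (fun y => η y ^ 4) :=
    aux_pow_supp hc 4 four_ne_zero
  obtain ⟨g1, g2, g3⟩ := aux_green hO huO hφ (hφs.trans hs) hφc
  have hfc : ContinuousOn (fun x => ‖x - x₀‖ ^ (2 * β) * Real.exp (u x)) Omega := by
    refine ContinuousOn.mul (ContinuousOn.rpow_const (by fun_prop) ?_) huO.continuousOn.rexp
    exact fun x hx => Or.inl (hne x hx).ne'
  have hI := aux_integrable hO hfc hφ.continuous (hφs.trans hs) hφc
  set I := ∫ x, ‖x - x₀‖ ^ (2 * β) * Real.exp (u x) * η x ^ 4 with hIdef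
  have hKI : ∫ x in K, ‖x - x₀‖ ^ (2 * β) * Real.exp (u x) ≤ I := by
    have : ∫ x in K, ‖x - x₀‖ ^ (2 * β) * Real.exp (u x)
        = ∫ x in K, ‖x - x₀‖ ^ (2 * β) * Real.exp (u x) * η x ^ 4 := by
      refine setIntegral_congr_fun hK.measurableSet fun x hx => ?_
      simp [hK1 x hx]
    rw [this]
    refine setIntegral_le_integral hI (Filter.Eventually.of_forall fun x => ?_)
    simp only [Pi.zero_apply]
    positivity
  have hA : a * I ≤ ∫ x, -(η x ^ 4 * lap u x) := by
    rw [hIdef, ← integral_const_mul]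
    refine integral_mono (hI.const_mul a) g1.neg fun x => ?_
    simp only
    by_cases hx : x ∈ Omega
    · have h4 : 0 ≤ η x ^ 4 := by positivity
      have := mul_le_mul_of_nonneg_right (hlow x hx) h4
      linarith
    · simp [image_eq_zero_of_notMem_tsupport (fun h => hx (hs h))]
  have hB : ∫ x, -(u x * lap (fun y => η y ^ 4) x)
      ≤ a / 2 * I + 2 / (a * w) * ∫ x, (auxG η x) ^ 2 := by
    rw [hIdef, ← integral_const_mul, ← integral_const_mul, ← integral_add (hI.const_mul _)
      (hGi.const_mul _)]
    refine integral_mono g2.neg ((hI.const_mul _).add (hGi.const_mul _)) fun x => ?_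
    simp only [aux_lap_pow hη]
    by_cases hx : x ∈ tsupport η
    · have hu0 := hupos x (hs hx)
      have hw1 := hW x₀ hx₀ x hx
      have hexp : Real.exp (u x) = Real.exp (u x / 2) ^ 2 := by
        rw [← Real.exp_nat_mul]; congr 1; push_cast; ring
      have hs2 : u x ≤ 2 * Real.exp (u x / 2) := by
        have := Real.add_one_le_exp (u x / 2)
        linarith
      have hsp := Real.exp_pos (u x / 2)
      rw [hexp]
      generalize Real.exp (u x / 2) = s at *
      generalize auxG η x = G
      have e1 : -(u x * (η x ^ 2 * G)) ≤ 2 * s * (η x ^ 2 * |G|) := by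
        have h1 : -(u x * (η x ^ 2 * G)) = u x * (η x ^ 2 * -G) := by ring
        rw [h1]
        have h2 : -G ≤ |G| := neg_le_abs G
        calc u x * (η x ^ 2 * -G) ≤ u x * (η x ^ 2 * |G|) := by gcongr
          _ ≤ 2 * s * (η x ^ 2 * |G|) := by gcongr
      have e2 : 2 * s * (η x ^ 2 * |G|) ≤ a / 2 * (w * s ^ 2 * η x ^ 4) + 2 / (a * w) * G ^ 2 := by
        have haw : 0 < a * w := by positivity
        have key : a / 2 * (w * s ^ 2 * η x ^ 4) + 2 / (a * w) * G ^ 2 - 2 * s * (η x ^ 2 * |G|)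
            = (a * w * (s * η x ^ 2) - 2 * |G|) ^ 2 / (2 * (a * w)) := by
          rw [← sq_abs G]
          field_simp
          ring
        have : 0 ≤ (a * w * (s * η x ^ 2) - 2 * |G|) ^ 2 / (2 * (a * w)) := by positivity
        linarith
      have e3 : a / 2 * (w * s ^ 2 * η x ^ 4) ≤ a / 2 * (‖x - x₀‖ ^ (2 * β) * s ^ 2 * η x ^ 4) := by
        gcongr
      linarith
    · have : 0 ≤ 2 / (a * w) * auxG η x ^ 2 := by positivity
      simpa [image_eq_zero_of_notMem_tsupport hx] using this
  rw [integral_neg] at hA hB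
  rw [g3] at hA
  have hfin : a / 2 * I ≤ 2 / (a * w) * ∫ x, (auxG η x) ^ 2 := by linarith
  have : I ≤ 2 / a * (2 / (a * w) * ∫ x, (auxG η x) ^ 2) := by
    calc I = 2 / a * (a / 2 * I) := by field_simp
      _ ≤ _ := by gcongr
  linarith
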